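/- arXiv:2008.08417 — 4 statements merged into one kernel-verified Lean document; each statement's English description precedes it below -/
import Mathlib

section
/- Cauchy–Davenport variant for subset sums: let p > 2 be a prime and let B be a multiset of p − 1 nonzero elements of ℤ/pℤ. Then every element of ℤ/pℤ can be written as the sum of the elements of some submultiset of B (the empty submultiset giving 0). -/
open scoped Pointwise in
theorem subset_sums_aux (p : ℕ) (hp : p.Prime) (B : Multiset (ZMod p)) :
    0 ∉ B → ∃ S : Finset (ZMod p), S.Nonempty ∧ (∀ t ∈ S, ∃ B' ≤ B, B'.sum = t) ∧
      min p (Multiset.card B + 1) ≤ S.card := by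
  induction B using Multiset.induction_on with
  | empty =>
    intro _
    refine ⟨{0}, by simp, ?_, by simp⟩
    intro t ht
    exact ⟨0, le_rfl, by simpa using (Finset.mem_singleton.mp ht).symm⟩
  | cons a B ih =>
    intro h0
    have ha : (0 : ZMod p) ≠ a := fun h => h0 (by simp [← h])
    obtain ⟨S, hS, hsum, hcard⟩ := ih (fun h => h0 (Multiset.mem_cons_of_mem h))
    refine ⟨S + {0, a}, hS.add (by simp), ?_, ?_⟩
    · intro t ht
      obtain ⟨s, hs, x, hx, rfl⟩ := Finset.mem_add.mp ht
      obtain ⟨B', hB', rfl⟩ := hsum s hs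
      rcases Finset.mem_insert.mp hx with rfl | hx
      · exact ⟨B', hB'.trans (Multiset.le_cons_self B a), by simp⟩
      · rw [Finset.mem_singleton] at hx
        subst hx
        exact ⟨x ::ₘ B', Multiset.cons_le_cons x hB', by simp [add_comm]⟩
    · have h := ZMod.cauchy_davenport hp hS (t := {0, a}) (by simp)
      rw [Finset.card_pair ha] at h
      rw [Multiset.card_cons]
      omega

/-- Cauchy–Davenport variant for subset sums: if `p > 2` is prime and `B` is a
multiset of `p - 1` nonzero elements of `ℤ/pℤ`, then every element of `ℤ/pℤ`
is the sum of the elements of some submultiset of `B`. -/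
theorem cauchy_davenport_subset_sums (p : ℕ) (hp : p.Prime) (hp2 : 2 < p)
    (B : Multiset (ZMod p)) (hcard : Multiset.card B = p - 1) (h0 : 0 ∉ B) :
    ∀ t : ZMod p, ∃ B' ≤ B, B'.sum = t := by
  intro t
  haveI : Fact p.Prime := ⟨hp⟩
  obtain ⟨S, -, hsum, hc⟩ := subset_sums_aux p hp B h0
  have hS : S = Finset.univ := by
    apply Finset.eq_univ_of_card
    apply le_antisymm (Finset.card_le_univ S)
    rw [ZMod.card]
    omega
  exact hsum t (by simp [hS])
end

section
/- Multiplicativity of the Erdős–Ginzburg–Ziv property: let u, v ≥ 1 be integers. Suppose that every multiset of 2u − 1 integers contains a submultiset of cardinality exactly u whose sum is divisible by u, and that every multiset of 2v − 1 integers contains a submultiset of cardinality exactly v whose sum is divisible by v. Then every multiset of 2uv − 1 integers contains a submultiset of cardinality exactly uv whose sum is divisible by uv. -/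
/-- `EGZ n` : every multiset of `2n - 1` integers contains a submultiset of
cardinality exactly `n` whose sum is divisible by `n`. -/
def EGZ (n : ℕ) : Prop :=
  ∀ A : Multiset ℤ, Multiset.card A = 2 * n - 1 →
    ∃ B ≤ A, Multiset.card B = n ∧ (n : ℤ) ∣ B.sum

/-- Greedy extraction: from at least `(k + 1) u - 1` integers one can extract `k` disjoint
blocks of size `u` whose sums are divisible by `u`. -/
lemma egz_extract (u : ℕ) (hu : 1 ≤ u) (h : EGZ u) (k : ℕ) :
    ∀ A : Multiset ℤ, (k + 1) * u - 1 ≤ Multiset.card A →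
      ∃ S : Multiset (Multiset ℤ), Multiset.card S = k ∧ S.sum ≤ A ∧
        ∀ B ∈ S, Multiset.card B = u ∧ (u : ℤ) ∣ B.sum := by
  induction k with
  | zero => intro A _; exact ⟨0, by simp⟩
  | succ k ih =>
    intro A hA
    have h1 : 2 * u - 1 ≤ Multiset.card A := by
      refine le_trans ?_ hA
      gcongr
      omega
    obtain ⟨A', hA', hc⟩ : ∃ A' ≤ A, Multiset.card A' = 2 * u - 1 := by
      induction A using Quotient.inductionOn with
      | h l =>
        have h2 : 2 * u - 1 ≤ l.length := h1
        refine ⟨(l.take (2 * u - 1) : List ℤ), ?_, ?_⟩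
        · exact Multiset.coe_le.2 (List.take_sublist _ _).subperm
        · rw [Multiset.coe_card, List.length_take, min_eq_left h2]
    obtain ⟨B, hB, hBc, hBs⟩ := h A' hc
    have hBA := hB.trans hA'
    obtain ⟨S, hS, hSA, hSB⟩ := ih (A - B) (by
      rw [Multiset.card_sub hBA, hBc]
      have : (k + 1 + 1) * u = (k + 1) * u + u := by ring
      omega)
    refine ⟨B ::ₘ S, by simp [hS], ?_, ?_⟩
    · rw [Multiset.sum_cons]
      calc B + S.sum ≤ B + (A - B) := by gcongr
        _ = A := add_tsub_cancel_of_le hBA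
    · intro C hC
      rcases Multiset.mem_cons.1 hC with rfl | hC
      · exact ⟨hBc, hBs⟩
      · exact hSB C hC

/-- A submultiset of an image is the image of a submultiset. -/
lemma exists_le_of_le_map {α β : Type*} (f : α → β) (S : Multiset α) :
    ∀ C ≤ S.map f, ∃ T ≤ S, T.map f = C := by
  classical
  induction S using Multiset.induction_on with
  | empty => intro C hC; exact ⟨0, le_rfl, by simpa [eq_comm] using hC⟩
  | cons a S ih =>
    intro C hC
    rw [Multiset.map_cons] at hC
    by_cases ha : f a ∈ C
    · obtain ⟨D, rfl⟩ := Multiset.exists_cons_of_mem ha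
      obtain ⟨T, hT, rfl⟩ := ih D ((Multiset.cons_le_cons_iff _).1 hC)
      exact ⟨a ::ₘ T, Multiset.cons_le_cons _ hT, by simp⟩
    · obtain ⟨T, hT, rfl⟩ := ih C ((Multiset.le_cons_of_notMem ha).1 hC)
      exact ⟨T, hT.trans (Multiset.le_cons_self _ _), rfl⟩

/-- Cardinality and sum of a union of blocks. -/
lemma egz_union (u : ℕ) (T : Multiset (Multiset ℤ))
    (hT : ∀ B ∈ T, Multiset.card B = u ∧ (u : ℤ) ∣ B.sum) :
    Multiset.card T.sum = u * Multiset.card T ∧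
      T.sum.sum = u * (T.map fun B => B.sum / (u : ℤ)).sum := by
  induction T using Multiset.induction_on with
  | empty => simp
  | cons B T ih =>
    obtain ⟨h1, h2⟩ := ih fun C hC => hT C (Multiset.mem_cons_of_mem hC)
    obtain ⟨h3, h4⟩ := hT B (Multiset.mem_cons_self _ _)
    constructor
    · rw [Multiset.sum_cons, Multiset.card_add, h1, h3, Multiset.card_cons]; ring
    · rw [Multiset.sum_cons, Multiset.sum_add, h2, Multiset.map_cons, Multiset.sum_cons, mul_add,
        Int.mul_ediv_cancel' h4]

/-- Multiplicativity of the Erdős–Ginzburg–Ziv property. -/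
theorem egz_multiplicative (u v : ℕ) (hu : 1 ≤ u) (hv : 1 ≤ v)
    (hEGZu : EGZ u) (hEGZv : EGZ v) : EGZ (u * v) := by
  intro A hA
  obtain ⟨S, hS, hSA, hSB⟩ := egz_extract u hu hEGZu (2 * v - 1) A (by
    rw [hA, Nat.sub_add_cancel (by omega)]
    apply le_of_eq
    congr 1
    ring)
  obtain ⟨C, hC, hCc, hCs⟩ := hEGZv (S.map fun B => B.sum / (u : ℤ)) (by simpa using hS)
  obtain ⟨T, hT, rfl⟩ := exists_le_of_le_map _ S C hC
  obtain ⟨h1, h2⟩ := egz_union u T fun B hB => hSB B (Multiset.mem_of_le hT hB)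
  rw [Multiset.card_map] at hCc
  refine ⟨T.sum, le_trans ?_ hSA, by rw [h1, hCc], ?_⟩
  · obtain ⟨R, rfl⟩ := Multiset.le_iff_exists_add.1 hT
    rw [Multiset.sum_add]
    exact Multiset.le_add_right _ _
  · rw [h2]
    push_cast
    exact mul_dvd_mul_left _ hCs
end

section
/- Disjoint extraction step of the EGZ proof: let u, v ≥ 1 be integers, and suppose that every multiset of 2u − 1 integers contains a submultiset of cardinality exactly u whose sum is divisible by u. Then every multiset A of 2uv − 1 integers contains 2v − 1 pairwise disjoint submultisets B_1, …, B_{2v−1} (that is, B_1 + B_2 + ⋯ + B_{2v−1} ≤ A as multisets), each of cardinality exactly u and each with sum divisible by u. -/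
theorem egz_extract_aux (u : ℕ) (hEGZu : EGZ u) (k : ℕ) :
    ∀ A : Multiset ℤ, u * (k + 1) - 1 ≤ Multiset.card A →
    ∃ B : Fin k → Multiset ℤ,
      (∑ i, B i) ≤ A ∧
      ∀ i, Multiset.card (B i) = u ∧ (u : ℤ) ∣ (B i).sum := by
  induction k with
  | zero =>
    intro A _
    exact ⟨fun _ => 0, by simp, fun i => i.elim0⟩
  | succ k ih =>
    intro A hA
    have e : u * (k + 1 + 1) = u * (k + 1) + u := by ring
    have e2 : u * (k + 1) = u * k + u := by ring
    have h1 : 2 * u - 1 ≤ Multiset.card A := by omega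
    obtain ⟨C, hC, hCc⟩ : ∃ C ≤ A, Multiset.card C = 2 * u - 1 := by
      induction A using Quotient.inductionOn with
      | h l =>
        refine ⟨(l.take (2 * u - 1) : Multiset ℤ), ?_, ?_⟩
        · exact Multiset.coe_le.2 (List.take_sublist _ _).subperm
        · simpa using h1
    obtain ⟨D, hD, hDc, hDs⟩ := hEGZu C hCc
    have hDA : D ≤ A := hD.trans hC
    obtain ⟨B, hB, hB2⟩ := ih (A - D) (by
      rw [Multiset.card_sub hDA, hDc]
      omega)
    refine ⟨Fin.cons D B, ?_, ?_⟩
    · rw [Fin.sum_univ_succ]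
      simp only [Fin.cons_zero, Fin.cons_succ]
      calc D + ∑ i, B i ≤ D + (A - D) := by gcongr
        _ = A := add_tsub_cancel_of_le hDA
    · intro i
      refine Fin.cases ?_ ?_ i
      · simpa using ⟨hDc, hDs⟩
      · intro j
        simpa using hB2 j

/-- Disjoint extraction step of the EGZ proof: assuming `EGZ u`, every multiset
of `2uv - 1` integers contains `2v - 1` pairwise disjoint submultisets, each of
cardinality exactly `u` and each with sum divisible by `u`. -/
theorem egz_disjoint_extraction (u v : ℕ) (hu : 1 ≤ u) (hv : 1 ≤ v)
    (hEGZu : EGZ u) (A : Multiset ℤ) (hA : Multiset.card A = 2 * (u * v) - 1) :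
    ∃ B : Fin (2 * v - 1) → Multiset ℤ,
      (∑ i, B i) ≤ A ∧
      ∀ i, Multiset.card (B i) = u ∧ (u : ℤ) ∣ (B i).sum := by
  refine egz_extract_aux u hEGZu (2 * v - 1) A ?_
  have e : 2 * v - 1 + 1 = 2 * v := by omega
  rw [hA, e]
  apply le_of_eq
  congr 1
  ring
end

section
/- Total symmetric-difference bound for the modular subset sum algorithm: let m ≥ 1, let s_1, …, s_n be elements of ℤ/mℤ, and for 0 ≤ i ≤ n let S_i ⊆ ℤ/mℤ be the set of all sums ∑_{j∈X} s_j over subsets X of {1, …, i}. Then ∑_{i=1}^{n} |S_{i−1} △ (S_{i−1} + s_i)| = 2 · ∑_{i=1}^{n} |S_i \ S_{i−1}| ≤ 2 · |S_n| ≤ 2m. -/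
/-- Total symmetric-difference bound: with `S i` the set of all subset sums of
`s₁, …, s_i` in `ℤ/mℤ`,
`∑_{i=1}^{n} |S_{i-1} △ (S_{i-1} + s_i)| = 2 ∑_{i=1}^{n} |S_i \ S_{i-1}| ≤ 2|S_n| ≤ 2m`. -/
theorem modular_subset_sum_symmDiff_bound (m n : ℕ) (hm : 1 ≤ m) (s : Fin n → ZMod m)
    (S : ℕ → Finset (ZMod m))
    (hS : ∀ i, S i =
      (Finset.filter (fun j : Fin n => (j : ℕ) < i) Finset.univ).powerset.image
        (fun X => ∑ j ∈ X, s j)) :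
    (∑ i : Fin n, (symmDiff (S i.val) ((S i.val).image (fun y => y + s i))).card)
      = 2 * ∑ i : Fin n, ((S (i.val + 1)) \ S i.val).card ∧
    2 * (∑ i : Fin n, ((S (i.val + 1)) \ S i.val).card) ≤ 2 * (S n).card ∧
    2 * (S n).card ≤ 2 * m := by
  have hstep : ∀ i : Fin n, S (i.val + 1) = S i.val ∪ (S i.val).image (fun y => y + s i) := by
    intro i
    have hf : (Finset.filter (fun j : Fin n => (j : ℕ) < i.val + 1) Finset.univ)
        = insert i (Finset.filter (fun j : Fin n => (j : ℕ) < i.val) Finset.univ) := by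
      ext j
      simp only [Finset.mem_filter, Finset.mem_univ, true_and, Finset.mem_insert, Fin.ext_iff]
      omega
    rw [hS, hS, hf, Finset.powerset_insert, Finset.image_union, Finset.image_image,
      Finset.image_image]
    congr 1
    apply Finset.image_congr
    intro X hX
    have hi : i ∉ X := by
      intro h
      have := Finset.mem_powerset.1 hX h
      simp at this
    simp [Finset.sum_insert hi, add_comm]
  have hmono : ∀ i, S i ⊆ S (i + 1) := by
    intro i
    rw [hS, hS]
    apply Finset.image_subset_image
    apply Finset.powerset_mono.2
    intro j
    simp only [Finset.mem_filter, Finset.mem_univ, true_and]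
    omega
  have htel : ∀ k, ∑ i ∈ Finset.range k, (S (i + 1) \ S i).card ≤ (S k).card := by
    intro k
    induction k with
    | zero => simp
    | succ k ih =>
      rw [Finset.sum_range_succ]
      have := Finset.card_sdiff_add_card_eq_card (hmono k)
      omega
  refine ⟨?_, ?_, ?_⟩
  · rw [Finset.mul_sum]
    apply Finset.sum_congr rfl
    intro i _
    rw [hstep i, Finset.union_sdiff_left]
    have hc : ((S i.val).image (fun y => y + s i)).card = (S i.val).card :=
      Finset.card_image_of_injective _ (add_left_injective (s i))
    generalize (S i.val).image (fun y => y + s i) = T at hc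
    rw [symmDiff_def, Finset.sup_eq_union, Finset.card_union_of_disjoint disjoint_sdiff_sdiff,
      Finset.card_sdiff_comm hc.symm]
    omega
  · rw [Fin.sum_univ_eq_sum_range (fun i => (S (i + 1) \ S i).card) n]
    exact Nat.mul_le_mul_left 2 (htel n)
  · haveI : NeZero m := ⟨by omega⟩
    have := Finset.card_le_univ (S n)
    rw [ZMod.card] at this
    omega
end
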